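/- Let p be a probability mass function on Fin n and let 1 ≤ k ≤ j ≤ n. Let E' be a random subset of Fin n (a Finset-valued random variable) such that |E'| = j almost surely and P(u ∈ E') = j·p(u) for every vertex u. Conditionally on E', let F be chosen uniformly at random among the k-element subsets of E'. Then P(u ∈ F) = k·p(u) for every vertex u. -/

import Mathlib

open MeasureTheory ENNReal

/-- The number of `k`-subsets of `s` through a given `u ∈ s` is `k / #s` times the number of all
`k`-subsets of `s`. -/
lemma card_mul_card_filter_mem_powersetCard {α : Type*} [DecidableEq α] {s : Finset α} {u : α}
    (hu : u ∈ s) {k : ℕ} (hk : 1 ≤ k) :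
    s.card * ((s.powersetCard k).filter (u ∈ ·)).card = k * s.card.choose k := by
  have h := Finset.card_filter_powersetCard_subset {u} s k (by simpa using hu) (by simpa using hk)
  simp only [Finset.singleton_subset_iff, Finset.card_singleton] at h
  have hs : 1 ≤ s.card := Finset.card_pos.2 ⟨u, hu⟩
  rw [h]
  obtain ⟨a, ha⟩ := Nat.exists_eq_add_of_le' hs
  obtain ⟨b, rfl⟩ := Nat.exists_eq_add_of_le' hk
  rw [ha, Nat.add_sub_cancel, Nat.add_sub_cancel, Nat.add_one_mul_choose_eq, mul_comm]

/-- Decomposition of an event along the values of a random element of a finite type. -/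
lemma measureReal_setOf_and_eq_sum {Ω β : Type*} [MeasurableSpace Ω] (μ : Measure Ω)
    [IsFiniteMeasure μ] [Fintype β] {X : Ω → β} (hX : ∀ b, MeasurableSet {ω | X ω = b})
    (A : Ω → Prop) (P : β → Prop) [DecidablePred P] :
    μ.real {ω | A ω ∧ P (X ω)} = ∑ b with P b, μ.real {ω | A ω ∧ X ω = b} := by
  have hX' (T : Set β) : MeasurableSet (X ⁻¹' T) := by
    rw [← Set.biUnion_preimage_singleton]
    exact MeasurableSet.biUnion T.to_countable fun b _ => hX b
  have h := sum_measureReal_preimage_singleton (μ := μ.restrict {ω | A ω})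
    (Finset.univ.filter P) (f := X) fun b _ => hX b
  simp only [measureReal_restrict_apply (hX' _)] at h
  convert h.symm using 2
  · ext ω
    simp [and_comm]
  · congr 1
    ext ω
    simp [and_comm]

/-- If nonnegative weights on a finite type sum to `c`, and are constantly `c / #T` on a nonempty
set `T`, then they vanish off `T`. -/
lemma eq_zero_of_sum_eq_of_eq_div_card {β : Type*} [Fintype β] {f : β → ℝ} (hf : ∀ b, 0 ≤ f b)
    {T : Finset β} (hT : T.Nonempty) {c : ℝ} (hsum : ∑ b, f b = c)
    (hc : ∀ b ∈ T, f b = c / T.card) {b : β} (hb : b ∉ T) : f b = 0 := by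
  classical
  have hTc : ∑ b ∈ T, f b = c := by
    have : (T.card : ℝ) ≠ 0 := by exact_mod_cast hT.card_ne_zero
    rw [Finset.sum_congr rfl hc, Finset.sum_const, nsmul_eq_mul]
    field_simp
  have hcompl : ∑ b ∈ Tᶜ, f b = 0 := by
    linarith [Finset.sum_add_sum_compl T f]
  exact (Finset.sum_eq_zero_iff_of_nonneg fun b _ => hf b).1 hcompl b (by simpa using hb)

/-- Top-down step of degree preservation in the simplicial Chung-Lu model: if `E'` is a random
`j`-set with per-vertex marginals `P(u ∈ E') = j * p u`, and conditionally on `E'` the set `F`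
is uniform among the `k`-element subsets of `E'`, then `P(u ∈ F) = k * p u`. -/
theorem uniform_subset_marginal
    {Ω : Type*} [MeasurableSpace Ω] (μ : Measure Ω) [IsProbabilityMeasure μ]
    (n k j : ℕ) (hk : 1 ≤ k) (hkj : k ≤ j) (hjn : j ≤ n)
    (p : Fin n → ℝ) (hp0 : ∀ v, 0 ≤ p v) (hp1 : ∑ v, p v = 1)
    (E' F : Ω → Finset (Fin n))
    (hE'meas : ∀ s : Finset (Fin n), MeasurableSet {ω | E' ω = s})
    (hFmeas : ∀ t : Finset (Fin n), MeasurableSet {ω | F ω = t})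
    (hE'card : ∀ᵐ ω ∂μ, (E' ω).card = j)
    (hE'marg : ∀ u : Fin n, μ {ω | u ∈ E' ω} = ENNReal.ofReal ((j : ℝ) * p u))
    (hcondUnif : ∀ s t : Finset (Fin n), s.card = j → t ⊆ s → t.card = k →
      μ {ω | E' ω = s ∧ F ω = t} = μ {ω | E' ω = s} / (j.choose k : ℝ≥0∞)) :
    ∀ u : Fin n, μ {ω | u ∈ F ω} = ENNReal.ofReal ((k : ℝ) * p u) := by
  intro u
  have hj : (j : ℝ) ≠ 0 := by exact_mod_cast (by omega : j ≠ 0)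
  have hslice (s : Finset (Fin n)) :
      μ.real {ω | E' ω = s ∧ u ∈ F ω} = if u ∈ s then k / j * μ.real {ω | E' ω = s} else 0 := by
    by_cases hs : s.card = j
    · have hcard : ((s.powersetCard k).card : ℝ) = j.choose k := by
        rw [Finset.card_powersetCard, hs]
      have hunif : ∀ t ∈ s.powersetCard k, μ.real {ω | E' ω = s ∧ F ω = t} =
          μ.real {ω | E' ω = s} / (s.powersetCard k).card := by
        intro t ht
        obtain ⟨hts, htk⟩ := Finset.mem_powersetCard.1 ht
        rw [hcard]
        simp [measureReal_def, hcondUnif s t hs hts htk]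
      have hsum : ∑ t, μ.real {ω | E' ω = s ∧ F ω = t} = μ.real {ω | E' ω = s} := by
        have h := measureReal_setOf_and_eq_sum μ hFmeas (fun ω => E' ω = s) fun _ => True
        simpa using h.symm
      have hzero (t : Finset (Fin n)) (ht : t ∉ s.powersetCard k) :
          μ.real {ω | E' ω = s ∧ F ω = t} = 0 :=
        eq_zero_of_sum_eq_of_eq_div_card (fun _ => measureReal_nonneg)
          (Finset.powersetCard_nonempty.2 (hs ▸ hkj)) hsum hunif ht
      rw [measureReal_setOf_and_eq_sum μ hFmeas (fun ω => E' ω = s) (u ∈ ·)]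
      split_ifs with hu
      · have hsub : (s.powersetCard k).filter (u ∈ ·) ⊆ Finset.univ.filter (u ∈ ·) :=
          Finset.filter_subset_filter _ (Finset.subset_univ _)
        rw [← Finset.sum_subset hsub fun t htu ht => hzero t fun h => ht <|
            Finset.mem_filter.2 ⟨h, (Finset.mem_filter.1 htu).2⟩,
          Finset.sum_congr rfl fun t ht => hunif t (Finset.mem_filter.1 ht).1,
          Finset.sum_const, nsmul_eq_mul, hcard]
        have hcount : (j : ℝ) * ((s.powersetCard k).filter (u ∈ ·)).card = k * j.choose k := by
          have h := card_mul_card_filter_mem_powersetCard hu hk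
          rw [hs] at h
          exact_mod_cast h
        have hchoose : (j.choose k : ℝ) ≠ 0 := by
          exact_mod_cast (Nat.choose_pos hkj).ne'
        field_simp
        linear_combination μ.real {ω | E' ω = s} * hcount
      · refine Finset.sum_eq_zero fun t ht => hzero t fun h => hu ?_
        exact (Finset.mem_powersetCard.1 h).1 (Finset.mem_filter.1 ht).2
    · have hnull : μ.real {ω | E' ω = s} = 0 := by
        rw [measureReal_eq_zero_iff]
        refine measure_mono_null ?_ (ae_iff.1 hE'card)
        rintro ω rfl
        exact hs
      have hnull' : μ.real {ω | E' ω = s ∧ u ∈ F ω} = 0 :=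
        measureReal_mono_null (fun ω h => h.1) hnull
      simp [hnull, hnull']
  have hE' : μ.real {ω | u ∈ E' ω} = j * p u := by
    rw [measureReal_def, hE'marg, ENNReal.toReal_ofReal (mul_nonneg j.cast_nonneg (hp0 u))]
  have hE'sum : μ.real {ω | u ∈ E' ω} = ∑ s with u ∈ s, μ.real {ω | E' ω = s} := by
    simpa using measureReal_setOf_and_eq_sum μ hE'meas (fun _ => True) (u ∈ ·)
  have hFsum : μ.real {ω | u ∈ F ω} = ∑ s, μ.real {ω | E' ω = s ∧ u ∈ F ω} := by
    simpa [and_comm] using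
      measureReal_setOf_and_eq_sum μ hE'meas (fun ω => u ∈ F ω) fun _ => True
  rw [← ofReal_measureReal (μ := μ) (s := {ω | u ∈ F ω}), hFsum,
    Finset.sum_congr rfl fun s _ => hslice s, ← Finset.sum_filter, ← Finset.mul_sum,
    ← hE'sum, hE']
  congr 1
  field_simp
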